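/- Let ε ∈ {1, −1} and v = (e_1 + ε e_n)/√2 ∈ R^{p,q}. Let x, x' ∈ R^n with ε·q(x) > 0 and ε·q(x') > 0. If x/q(x) − x'/q(x') = 2ε(⟨x,v⟩/q(x) − ⟨x',v⟩/q(x'))·v, then x = x'. -/

import Mathlib

/-- The quadratic form `q` of signature `(p,q)` on `ℝ^n`, `n = p + q`. -/
noncomputable def qpq (p q : ℕ) (x : Fin (p + q) → ℝ) : ℝ :=
  2 * ∑ i : Fin p, x ⟨i, by omega⟩ * x ⟨p + q - 1 - i, by omega⟩
    + ∑ i : Fin (q - p), x ⟨p + i, by omega⟩ ^ 2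

/-- The polarization `⟨·,·⟩` of `q`. -/
noncomputable def bpq (p q : ℕ) (x y : Fin (p + q) → ℝ) : ℝ :=
  ∑ i : Fin p,
      (x ⟨i, by omega⟩ * y ⟨p + q - 1 - i, by omega⟩ +
        x ⟨p + q - 1 - i, by omega⟩ * y ⟨i, by omega⟩)
    + ∑ i : Fin (q - p), x ⟨p + i, by omega⟩ * y ⟨p + i, by omega⟩

/-- The `k`-th standard basis vector of `ℝ^n` (0-indexed). -/
noncomputable def stdb (p q : ℕ) (k : ℕ) : Fin (p + q) → ℝ :=
  fun j => if (j : ℕ) = k then 1 else 0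

theorem qpq_smul (p q : ℕ) (c : ℝ) (x : Fin (p + q) → ℝ) :
    qpq p q (c • x) = c ^ 2 * qpq p q x := by
  simp only [qpq, Pi.smul_apply, smul_eq_mul, mul_add, Finset.mul_sum]
  congr 1 <;> exact Finset.sum_congr rfl fun i _ => by ring

/-- Pairing with a multiple of `e₁ + ε e_n` only sees the first and last coordinates. -/
theorem bpq_smul_stdb_add (p q : ℕ) (hp : 1 ≤ p) (hpq : p ≤ q) (s ε : ℝ)
    (x : Fin (p + q) → ℝ) :
    bpq p q x (s • (stdb p q 0 + ε • stdb p q (p + q - 1)))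
      = s * (ε * x ⟨0, by omega⟩ + x ⟨p + q - 1, by omega⟩) := by
  unfold bpq
  have hmid : ∀ i : Fin (q - p), x ⟨p + i, by omega⟩ *
      (s • (stdb p q 0 + ε • stdb p q (p + q - 1))) ⟨p + i, by omega⟩ = 0 := by
    intro i
    have h₁ : ¬ (p + (i : ℕ) = 0) := by omega
    have h₂ : ¬ (p + (i : ℕ) = p + q - 1) := by omega
    simp only [Pi.smul_apply, Pi.add_apply, smul_eq_mul, stdb, if_neg h₁, if_neg h₂]
    ring
  rw [Finset.sum_eq_zero fun i _ => hmid i, add_zero,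
    Finset.sum_eq_single (⟨0, hp⟩ : Fin p)]
  · have h₁ : ¬ (p + q - 1 = 0) := by omega
    have h₂ : ¬ (0 = p + q - 1) := by omega
    simp only [Pi.smul_apply, Pi.add_apply, smul_eq_mul, stdb, Nat.sub_zero, if_neg h₁,
      if_neg h₂, if_true]
    ring
  · intro i _ hi
    have h₀ : ¬ ((i : ℕ) = 0) := fun h => hi (Fin.ext h)
    have h₁ : ¬ ((i : ℕ) = p + q - 1) := by omega
    have h₂ : ¬ (p + q - 1 - (i : ℕ) = 0) := by omega
    have h₃ : ¬ (p + q - 1 - (i : ℕ) = p + q - 1) := by omega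
    simp only [Pi.smul_apply, Pi.add_apply, smul_eq_mul, stdb, if_neg h₀, if_neg h₁,
      if_neg h₂, if_neg h₃]
    ring
  · exact fun h => absurd (Finset.mem_univ _) h

/-- The inversion `x ↦ x / q(x)` is injective on non-isotropic vectors. -/
theorem eq_of_inv_qpq_smul_eq (p q : ℕ) {x x' : Fin (p + q) → ℝ}
    (hx : qpq p q x ≠ 0) (hx' : qpq p q x' ≠ 0)
    (h : (qpq p q x)⁻¹ • x = (qpq p q x')⁻¹ • x') : x = x' := by
  have hq := congrArg (qpq p q) h
  rw [qpq_smul, qpq_smul] at hq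
  have hqq : qpq p q x = qpq p q x' := by
    field_simp at hq
    exact hq.symm
  rw [hqq] at h
  exact smul_right_injective _ (inv_ne_zero hx') h

/-- For `ε = ±1` and `v = (e₁ + ε e_n)/√2`, if `ε q(x) > 0`, `ε q(x') > 0` and
`x/q(x) − x'/q(x') = 2ε(⟨x,v⟩/q(x) − ⟨x',v⟩/q(x'))·v`, then `x = x'`. -/
theorem limit_relation_forces_equal (p q : ℕ) (hp : 1 ≤ p) (hpq : p ≤ q)
    (hn : 3 ≤ p + q) (ε : ℝ) (hε : ε = 1 ∨ ε = -1)
    (v : Fin (p + q) → ℝ)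
    (hv : v = (Real.sqrt 2)⁻¹ • (stdb p q 0 + ε • stdb p q (p + q - 1)))
    (x x' : Fin (p + q) → ℝ)
    (hqx : ε * qpq p q x > 0) (hqx' : ε * qpq p q x' > 0)
    (heq : (qpq p q x)⁻¹ • x - (qpq p q x')⁻¹ • x'
        = (2 * ε * (bpq p q x v / qpq p q x - bpq p q x' v / qpq p q x')) • v) :
    x = x' := by
  have hx : qpq p q x ≠ 0 := right_ne_zero_of_mul hqx.ne'
  have hx' : qpq p q x' ≠ 0 := right_ne_zero_of_mul hqx'.ne'
  refine eq_of_inv_qpq_smul_eq p q hx hx' (sub_eq_zero.mp ?_)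
  have hs : (Real.sqrt 2)⁻¹ ^ 2 = 1 / 2 := by
    rw [inv_pow, Real.sq_sqrt (by norm_num)]
    norm_num
  have hε2 : ε ^ 2 = 1 := by rcases hε with rfl | rfl <;> norm_num
  have hn₁ : ¬ (p + q - 1 = 0) := by omega
  have hn₂ : ¬ (0 = p + q - 1) := by omega
  have hfirst := congrFun heq ⟨0, by omega⟩
  have hlast := congrFun heq ⟨p + q - 1, by omega⟩
  rw [hv, bpq_smul_stdb_add p q hp hpq, bpq_smul_stdb_add p q hp hpq] at heq hfirst hlast
  simp only [Pi.smul_apply, Pi.add_apply, Pi.sub_apply, smul_eq_mul, stdb, if_neg hn₁,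
    if_neg hn₂, if_true, div_eq_mul_inv] at hfirst hlast
  rw [heq]
  generalize (Real.sqrt 2)⁻¹ = s at *
  generalize x ⟨0, _⟩ = a at *
  generalize x ⟨p + q - 1, _⟩ = b at *
  generalize x' ⟨0, _⟩ = a' at *
  generalize x' ⟨p + q - 1, _⟩ = b' at *
  simp only [div_eq_mul_inv]
  generalize (qpq p q x)⁻¹ = r at *
  generalize (qpq p q x')⁻¹ = r' at *
  have ht : ε * (r * a - r' * a') + (r * b - r' * b') = 0 := by
    linear_combination (-ε) * hfirst - hlast
      - 4 * ε ^ 2 * (ε * (r * a - r' * a') + (r * b - r' * b')) * hs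
      - 2 * (ε * (r * a - r' * a') + (r * b - r' * b')) * hε2
  have hk : 2 * ε * (s * (ε * a + b) * r - s * (ε * a' + b') * r') = 0 := by
    linear_combination 2 * ε * s * ht
  rw [hk, zero_smul]
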